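/- arXiv:2503.09724 — 13 statements merged into one kernel-verified Lean document; each statement's English description precedes it below -/
import Mathlib

section
/- Let R be an associative ring that is an algebra over ℝ, and let N ≥ 2. Let a₀, a₁ ∈ R and, for i = 2,…,N, let bᵢ, cᵢ ∈ R satisfy a₀² = a₁² = 1, bᵢ² = cᵢ² = 1, each of a₀, a₁ commutes with every bᵢ and cᵢ, and bᵢ, cᵢ commute with bⱼ, cⱼ whenever i ≠ j. Set ã₁ = (1/√2)·(a₀ + a₁) and ã₀ = (1/√2)·(a₀ − a₁), and fix signs ε₁,…,ε_N ∈ {−1, 1}. Define the Bell operator Î = ε₁·((N−1)·ã₁·c₂⋯c_N + ∑_{i=2}^{N} εᵢ·ã₀·bᵢ). Then the sum-of-squares identity 2·(2(N−1)·1 − Î) = (N−1)·(1 − ε₁·ã₁·c₂⋯c_N)² + ∑_{i=2}^{N} (1 − ε₁·εᵢ·ã₀·bᵢ)² holds in R. -/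
/-- A product of pairwise commuting involutions is an involution. -/
theorem List.prod_pow_two_eq_one_of_pairwise_commute {M : Type*} [Monoid M] (l : List M)
    (hcomm : l.Pairwise Commute) (hsq : ∀ x ∈ l, x ^ 2 = 1) : l.prod ^ 2 = 1 := by
  induction l with
  | nil => simp
  | cons x l ih =>
    rw [List.pairwise_cons] at hcomm
    rw [List.prod_cons, (Commute.list_prod_right l x hcomm.1).mul_pow,
      hsq x List.mem_cons_self, ih hcomm.2 fun y hy => hsq y (List.mem_cons_of_mem x hy), one_mul]

/-- The square `(1 - e * (t * x)) ^ 2` for a sign `e` and an involution `x` commuting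
with `t`. -/
theorem one_sub_sign_mul_sq {R : Type*} [Ring R] {e t x : R} (he : e = 1 ∨ e = -1)
    (htx : Commute t x) (hx : x ^ 2 = 1) :
    (1 - e * (t * x)) ^ 2 = 1 + t ^ 2 - 2 * (e * (t * x)) := by
  have h : (t * x) ^ 2 = t ^ 2 := by rw [htx.mul_pow, hx, mul_one]
  rw [← h]
  rcases he with rfl | rfl <;> noncomm_ring

/-- The squares of the rotated observables `(a₀ ± a₁) / √2` add up to `2`. -/
theorem rotated_sq_add_sq {R : Type*} [Ring R] [Algebra ℝ R] {a₀ a₁ : R}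
    (ha₀ : a₀ ^ 2 = 1) (ha₁ : a₁ ^ 2 = 1) :
    ((Real.sqrt 2)⁻¹ • (a₀ + a₁)) ^ 2 + ((Real.sqrt 2)⁻¹ • (a₀ - a₁)) ^ 2 = 2 := by
  have hsum : (a₀ + a₁) ^ 2 + (a₀ - a₁) ^ 2 = (2 : ℝ) • (2 : R) := by
    have : (a₀ + a₁) ^ 2 + (a₀ - a₁) ^ 2 = 2 * (a₀ ^ 2 + a₁ ^ 2) := by noncomm_ring
    rw [this, ha₀, ha₁, two_smul]
    norm_num
  rw [smul_pow, smul_pow, ← smul_add, hsum, smul_smul, inv_pow, Real.sq_sqrt zero_le_two,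
    inv_mul_cancel₀ two_ne_zero, one_smul]


/-- sum-of-squares identity
`2·(2(N−1)·1 − Î) = (N−1)·(1 − ε₁·ã₁·c₂⋯c_N)² + ∑_{i=2}^{N} (1 − ε₁·εᵢ·ã₀·bᵢ)²`
for the Bell operator `Î` in an ℝ-algebra `R`. -/
theorem sos_identity_simple
    (R : Type*) [Ring R] [Algebra ℝ R]
    (N : ℕ) [NeZero N] (hN : 2 ≤ N)
    (a₀ a₁ : R) (b c ε : Fin N → R)
    (ha₀ : a₀ ^ 2 = 1) (ha₁ : a₁ ^ 2 = 1)
    (hb : ∀ i : Fin N, i ≠ 0 → b i ^ 2 = 1)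
    (hc : ∀ i : Fin N, i ≠ 0 → c i ^ 2 = 1)
    (hab : ∀ i : Fin N, i ≠ 0 →
      Commute a₀ (b i) ∧ Commute a₀ (c i) ∧ Commute a₁ (b i) ∧ Commute a₁ (c i))
    (hbc : ∀ i j : Fin N, i ≠ 0 → j ≠ 0 → i ≠ j →
      Commute (b i) (b j) ∧ Commute (b i) (c j) ∧
      Commute (c i) (b j) ∧ Commute (c i) (c j))
    (hε : ∀ i, ε i = 1 ∨ ε i = -1) :
    let ta₁ : R := (Real.sqrt 2)⁻¹ • (a₀ + a₁)
    let ta₀ : R := (Real.sqrt 2)⁻¹ • (a₀ - a₁)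
    let C : R := (((List.finRange N).filter fun i => decide (i ≠ 0)).map c).prod
    let I : R := ε 0 * (((N : ℝ) - 1) • (ta₁ * C) +
      ∑ i ∈ Finset.univ.filter (fun i : Fin N => i ≠ 0), ε i * (ta₀ * b i))
    (2 : R) * ((2 * ((N : ℝ) - 1)) • (1 : R) - I) =
      ((N : ℝ) - 1) • (1 - ε 0 * (ta₁ * C)) ^ 2 +
      ∑ i ∈ Finset.univ.filter (fun i : Fin N => i ≠ 0),
        (1 - ε 0 * ε i * (ta₀ * b i)) ^ 2 := by
  intro ta₁ ta₀ C I
  have hta : ta₁ ^ 2 + ta₀ ^ 2 = 2 := rotated_sq_add_sq ha₀ ha₁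
  have hC : C ^ 2 = 1 := by
    refine List.prod_pow_two_eq_one_of_pairwise_commute _ ?_ ?_
    · rw [List.pairwise_map]
      refine ((List.nodup_finRange N).filter _).imp_of_mem fun {i j} hi hj hij => ?_
      have hi0 : i ≠ 0 := by simpa using hi
      have hj0 : j ≠ 0 := by simpa using hj
      exact (hbc i j hi0 hj0 hij).2.2.2
    · intro x hx
      obtain ⟨i, hi, rfl⟩ := List.mem_map.1 hx
      exact hc i (by simpa using hi)
  have htC : Commute ta₁ C := by
    refine Commute.list_prod_right _ _ fun x hx => ?_
    obtain ⟨i, hi, rfl⟩ := List.mem_map.1 hx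
    have h := hab i (by simpa using hi)
    exact (h.2.1.add_left h.2.2.2).smul_left _
  have hterm : ∀ i ∈ Finset.univ.filter (fun i : Fin N => i ≠ 0),
      (1 - ε 0 * ε i * (ta₀ * b i)) ^ 2 =
        (1 + ta₀ ^ 2) - 2 * (ε 0 * (ε i * (ta₀ * b i))) := by
    intro i hi
    have hi0 : i ≠ 0 := by simpa using hi
    have h := hab i hi0
    have hsign : ε 0 * ε i = 1 ∨ ε 0 * ε i = -1 := by
      rcases hε 0 with h0 | h0 <;> rcases hε i with h1 | h1 <;> simp [h0, h1]
    rw [one_sub_sign_mul_sq hsign ((h.1.sub_left h.2.2.1).smul_left _) (hb i hi0),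
      mul_assoc (ε 0)]
  have hcard : ((Finset.univ.filter (fun i : Fin N => i ≠ 0)).card : ℝ) = (N : ℝ) - 1 := by
    rw [Finset.filter_ne', Finset.card_erase_of_mem (Finset.mem_univ _), Finset.card_univ,
      Fintype.card_fin, Nat.cast_pred (by omega)]
  rw [Finset.sum_congr rfl hterm, Finset.sum_sub_distrib, Finset.sum_const,
    ← Nat.cast_smul_eq_nsmul ℝ, hcard, ← Finset.mul_sum, ← Finset.mul_sum,
    one_sub_sign_mul_sq (hε 0) htC hC, eq_sub_of_add_eq' hta]
  simp only [I, two_mul, mul_add, mul_smul_comm]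
  rw [← one_add_one_eq_two (R := R)]
  module
end

section
/- Let R be an associative ring that is an algebra over ℝ, and let N ≥ 2. Let a₀, a₁ ∈ R and, for i = 2,…,N, let bᵢ, cᵢ ∈ R satisfy a₀² = a₁² = 1, bᵢ² = cᵢ² = 1, each of a₀, a₁ commutes with every bᵢ and cᵢ, and bᵢ, cᵢ commute with bⱼ, cⱼ whenever i ≠ j. Set ã₁ = (1/√2)·(a₀ + a₁) and ã₀ = (1/√2)·(a₀ − a₁), fix signs ε₁,…,ε_N ∈ {−1, 1}, and define Î = ε₁·((N−1)·ã₁·c₂⋯c_N + ∑_{i=2}^{N} εᵢ·ã₀·bᵢ). For 2 ≤ i < j ≤ N set Q_{ij} = ã₀·(εᵢ·bᵢ − εⱼ·bⱼ), and for j = 2,…,N set Tⱼ = ã₁·bⱼ·∏_{i=2, i≠j}^{N} cᵢ + εⱼ·ã₀·cⱼ. Then the sum-of-squares identity 2·(2(N−1))·(2(N−1)·1 − Î) = (2(N−1)·1 − Î)² + ∑_{2 ≤ i < j ≤ N} Q_{ij}² + (N−1)·∑_{j=2}^{N} Tⱼ² holds in R. -/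
/-- In a list without repetitions a factor commuting with all the others can be moved to the
front of the product. -/
lemma List.prod_map_eq_mul_prod_filter_ne {M ι : Type*} [Monoid M] [DecidableEq ι] (f : ι → M)
    {l : List ι} (hl : l.Nodup) {j : ι} (hj : j ∈ l)
    (hf : ∀ i ∈ l, i ≠ j → Commute (f j) (f i)) :
    (l.map f).prod = f j * ((l.filter fun i => decide (i ≠ j)).map f).prod := by
  induction l with
  | nil => simp at hj
  | cons a l ih =>
    rw [List.nodup_cons] at hl
    by_cases haj : a = j
    · subst haj
      have hself : l.filter (fun i => decide (i ≠ a)) = l := by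
        rw [List.filter_eq_self]
        intro i hi
        simpa using ne_of_mem_of_not_mem hi hl.1
      rw [List.filter_cons_of_neg (by simp), hself, List.map_cons, List.prod_cons]
    · have hjl : j ∈ l := by
        rcases List.mem_cons.1 hj with h | h
        · exact absurd h.symm haj
        · exact h
      rw [List.filter_cons_of_pos (by simpa using haj), List.map_cons, List.prod_cons,
        List.map_cons, List.prod_cons,
        ih hl.2 hjl fun i hi => hf i (List.mem_cons_of_mem _ hi), ← mul_assoc, ← mul_assoc,
        (hf a List.mem_cons_self haj).eq]

/-- A product of pairwise commuting involutions is an involution. -/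
lemma List.prod_map_sq_eq_one {M ι : Type*} [Monoid M] (f : ι → M) {l : List ι}
    (hl : l.Nodup) (hsq : ∀ i ∈ l, f i ^ 2 = 1)
    (hf : ∀ i ∈ l, ∀ j ∈ l, i ≠ j → Commute (f i) (f j)) : (l.map f).prod ^ 2 = 1 := by
  induction l with
  | nil => simp
  | cons a l ih =>
    rw [List.nodup_cons] at hl
    have hcomm : Commute (f a) (l.map f).prod := by
      refine Commute.list_prod_right _ _ fun x hx => ?_
      obtain ⟨i, hi, rfl⟩ := List.mem_map.1 hx
      exact hf a List.mem_cons_self i (List.mem_cons_of_mem _ hi)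
        (ne_of_mem_of_not_mem hi hl.1).symm
    rw [List.map_cons, List.prod_cons, hcomm.mul_pow, hsq a List.mem_cons_self, one_mul]
    exact ih hl.2 (fun i hi => hsq i (List.mem_cons_of_mem _ hi))
      fun i hi j hj => hf i (List.mem_cons_of_mem _ hi) j (List.mem_cons_of_mem _ hj)

/-- A symmetric double sum with vanishing diagonal is twice the sum over ordered pairs. -/
lemma Finset.sum_sum_eq_two_nsmul_sum_lt {M ι : Type*} [AddCommMonoid M] [LinearOrder ι]
    (s : Finset ι) (f : ι → ι → M) (hsymm : ∀ i j, f i j = f j i) (hdiag : ∀ i, f i i = 0) :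
    ∑ i ∈ s, ∑ j ∈ s, f i j =
      2 • ∑ p ∈ (s ×ˢ s).filter (fun p => p.1 < p.2), f p.1 p.2 := by
  have hswap : ∑ p ∈ (s ×ˢ s).filter (fun p => p.2 < p.1), f p.1 p.2 =
      ∑ p ∈ (s ×ˢ s).filter (fun p => p.1 < p.2), f p.1 p.2 := by
    refine Finset.sum_nbij' Prod.swap Prod.swap ?_ ?_ ?_ ?_ ?_ <;>
      simp +contextual [hsymm]
  have hle : ∑ p ∈ (s ×ˢ s).filter (fun p => ¬ p.1 < p.2), f p.1 p.2 =
      ∑ p ∈ (s ×ˢ s).filter (fun p => p.2 < p.1), f p.1 p.2 := by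
    symm
    refine Finset.sum_subset (fun p hp => ?_) fun p hp hp' => ?_
    · simp only [Finset.mem_filter] at hp ⊢
      exact ⟨hp.1, hp.2.not_gt⟩
    · simp only [Finset.mem_filter, not_and, not_lt] at hp hp'
      rw [le_antisymm (hp' hp.1) hp.2, hdiag]
  rw [← Finset.sum_product', ← Finset.sum_filter_add_sum_filter_not (s ×ˢ s)
    (fun p => p.1 < p.2), hle, hswap, two_nsmul]

/-- For commuting involutions, `∑_{i < j} (dᵢ - dⱼ)² = n² - (∑ dᵢ)²`. -/
lemma Finset.sum_lt_sub_sq_of_involutive {R ι : Type*} [Ring R] [Algebra ℝ R] [LinearOrder ι]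
    (s : Finset ι) (d : ι → R) (hsq : ∀ i ∈ s, d i ^ 2 = 1)
    (hcomm : ∀ i ∈ s, ∀ j ∈ s, Commute (d i) (d j)) :
    ∑ p ∈ (s ×ˢ s).filter (fun p => p.1 < p.2), (d p.1 - d p.2) ^ 2 =
      ((s.card : ℝ) ^ 2) • (1 : R) - (∑ i ∈ s, d i) ^ 2 := by
  have hdouble := Finset.sum_sum_eq_two_nsmul_sum_lt s (fun i j => (d i - d j) ^ 2)
    (fun i j => by rw [← neg_sub, neg_sq]) (fun i => by simp)
  have hterm : ∀ i ∈ s, ∀ j ∈ s, (d i - d j) ^ 2 = (2 : ℝ) • (1 : R) - (2 : ℝ) • (d i * d j) := by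
    intro i hi j hj
    have hexpand : (d i - d j) ^ 2 = d i ^ 2 + d j ^ 2 - d i * d j - d j * d i := by noncomm_ring
    rw [hexpand, hsq i hi, hsq j hj, (hcomm i hi j hj).eq]
    module
  have hsum : ∑ i ∈ s, ∑ j ∈ s, (d i - d j) ^ 2 =
      (2 : ℝ) • (((s.card : ℝ) ^ 2) • (1 : R) - (∑ i ∈ s, d i) ^ 2) := by
    rw [Finset.sum_congr rfl fun i hi => Finset.sum_congr rfl (hterm i hi), sq (∑ i ∈ s, d i),
      Finset.sum_mul_sum]
    simp only [Finset.sum_sub_distrib, Finset.sum_const, ← Finset.smul_sum,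
      ← Nat.cast_smul_eq_nsmul ℝ]
    module
  rw [hsum, ← Nat.cast_smul_eq_nsmul ℝ] at hdouble
  exact (smul_right_injective R (two_ne_zero' ℝ) hdouble).symm

/-- the second sum-of-squares identity
`2·(2(N−1))·(2(N−1)·1 − Î) = (2(N−1)·1 − Î)² + ∑_{2 ≤ i < j ≤ N} Q_{ij}² + (N−1)·∑_{j=2}^N Tⱼ²`
for the Bell operator `Î` in an ℝ-algebra `R`. -/
theorem sos_identity_squared
    (R : Type*) [Ring R] [Algebra ℝ R]
    (N : ℕ) [NeZero N] (hN : 2 ≤ N)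
    (a₀ a₁ : R) (b c ε : Fin N → R)
    (ha₀ : a₀ ^ 2 = 1) (ha₁ : a₁ ^ 2 = 1)
    (hb : ∀ i : Fin N, i ≠ 0 → b i ^ 2 = 1)
    (hc : ∀ i : Fin N, i ≠ 0 → c i ^ 2 = 1)
    (hab : ∀ i : Fin N, i ≠ 0 →
      Commute a₀ (b i) ∧ Commute a₀ (c i) ∧ Commute a₁ (b i) ∧ Commute a₁ (c i))
    (hbc : ∀ i j : Fin N, i ≠ 0 → j ≠ 0 → i ≠ j →
      Commute (b i) (b j) ∧ Commute (b i) (c j) ∧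
      Commute (c i) (b j) ∧ Commute (c i) (c j))
    (hε : ∀ i, ε i = 1 ∨ ε i = -1) :
    let ta₁ : R := (Real.sqrt 2)⁻¹ • (a₀ + a₁)
    let ta₀ : R := (Real.sqrt 2)⁻¹ • (a₀ - a₁)
    let C : R := (((List.finRange N).filter fun i => decide (i ≠ 0)).map c).prod
    let I : R := ε 0 * (((N : ℝ) - 1) • (ta₁ * C) +
      ∑ i ∈ Finset.univ.filter (fun i : Fin N => i ≠ 0), ε i * (ta₀ * b i))
    let Q : Fin N → Fin N → R := fun i j => ta₀ * (ε i * b i - ε j * b j)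
    let T : Fin N → R := fun j =>
      ta₁ * b j * (((List.finRange N).filter fun i => decide (i ≠ 0 ∧ i ≠ j)).map c).prod
        + ε j * (ta₀ * c j)
    ((2 : ℝ) * (2 * ((N : ℝ) - 1))) • ((2 * ((N : ℝ) - 1)) • (1 : R) - I) =
      ((2 * ((N : ℝ) - 1)) • (1 : R) - I) ^ 2 +
      ∑ p ∈ Finset.univ.filter
          (fun p : Fin N × Fin N => p.1 ≠ 0 ∧ p.2 ≠ 0 ∧ p.1 < p.2),
        Q p.1 p.2 ^ 2 +
      ((N : ℝ) - 1) •
        ∑ j ∈ Finset.univ.filter (fun j : Fin N => j ≠ 0), T j ^ 2 := by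
  intro ta₁ ta₀ C I Q T
  obtain ⟨m, hm⟩ : ∃ m : ℝ, m = (N : ℝ) - 1 := ⟨_, rfl⟩
  set S : Finset (Fin N) := Finset.univ.filter (fun i : Fin N => i ≠ 0) with hS
  have hmemS : ∀ i, i ∈ S ↔ i ≠ 0 := by simp [hS]
  have hcard : (S.card : ℝ) = m := by
    rw [hS, Finset.filter_ne', Finset.card_erase_of_mem (Finset.mem_univ _), Finset.card_univ,
      Fintype.card_fin, Nat.cast_sub (by omega), Nat.cast_one, hm]
  have hε_comm : ∀ i z, Commute (ε i) z := by
    intro i z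
    rcases hε i with h | h <;> rw [h]
    · exact Commute.one_left z
    · exact (Commute.one_left z).neg_left
  have hε_sq : ∀ i, ε i ^ 2 = 1 := by
    intro i
    rcases hε i with h | h <;> simp [h]
  have hsqrt : (Real.sqrt 2)⁻¹ * (Real.sqrt 2)⁻¹ = 2⁻¹ := by
    rw [← mul_inv, Real.mul_self_sqrt zero_le_two]
  have h_anti : ta₀ * ta₁ = -(ta₁ * ta₀) := by
    simp only [ta₀, ta₁, smul_mul_smul_comm, hsqrt, ← smul_neg]
    congr 1
    have hexpand : (a₀ - a₁) * (a₀ + a₁) + (a₀ + a₁) * (a₀ - a₁) = 2 • (a₀ ^ 2 - a₁ ^ 2) := by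
      noncomm_ring
    rw [ha₀, ha₁, sub_self, smul_zero] at hexpand
    exact eq_neg_of_add_eq_zero_left hexpand
  have h_sq : ta₁ ^ 2 = (2 : ℝ) • (1 : R) - ta₀ ^ 2 := by
    simp only [ta₀, ta₁, sq, smul_mul_smul_comm, hsqrt]
    have hexpand : (a₀ + a₁) * (a₀ + a₁) = 2 • (a₀ ^ 2 + a₁ ^ 2) - (a₀ - a₁) * (a₀ - a₁) := by
      noncomm_ring
    rw [hexpand, ha₀, ha₁]
    module
  have h₁ : ∀ z, Commute a₀ z → Commute a₁ z → Commute ta₁ z := fun z h h' =>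
    (h.add_left h').smul_left _
  have h₀ : ∀ z, Commute a₀ z → Commute a₁ z → Commute ta₀ z := fun z h h' =>
    (h.sub_left h').smul_left _
  clear_value ta₀ ta₁
  set d : Fin N → R := fun i => ε i * b i with hd
  set B : R := ∑ i ∈ S, d i with hB
  have ha_d : ∀ i ∈ S, Commute a₀ (d i) ∧ Commute a₁ (d i) := fun i hi =>
    have h := hab i ((hmemS i).1 hi)
    ⟨(hε_comm i a₀).symm.mul_right h.1, (hε_comm i a₁).symm.mul_right h.2.2.1⟩
  have hd_sq : ∀ i ∈ S, d i ^ 2 = 1 := by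
    intro i hi
    rw [hd, (hε_comm i (b i)).mul_pow, hε_sq, hb i ((hmemS i).1 hi), one_mul]
  have hd_comm : ∀ i ∈ S, ∀ j ∈ S, Commute (d i) (d j) := by
    intro i hi j hj
    by_cases hij : i = j
    · rw [hij]
    · exact (hε_comm i _).mul_left ((hε_comm j _).symm.mul_right
        (hbc i j ((hmemS i).1 hi) ((hmemS j).1 hj) hij).1)
  have hB₀ : Commute a₀ B := Commute.sum_right _ _ _ fun i hi => (ha_d i hi).1
  have hB₁ : Commute a₁ B := Commute.sum_right _ _ _ fun i hi => (ha_d i hi).2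
  have ha_prod : ∀ p : Fin N → Bool, (∀ i, p i = true → i ≠ 0) →
      Commute a₀ (((List.finRange N).filter p).map c).prod ∧
      Commute a₁ (((List.finRange N).filter p).map c).prod := by
    intro p hp
    constructor <;>
    · refine Commute.list_prod_right _ _ fun x hx => ?_
      obtain ⟨i, hi, rfl⟩ := List.mem_map.1 hx
      have h := hab i (hp i (List.mem_filter.1 hi).2)
      first | exact h.2.1 | exact h.2.2.2
  obtain ⟨hC₀, hC₁⟩ : Commute a₀ C ∧ Commute a₁ C := ha_prod _ fun i hi => by simpa using hi
  have hC_sq : C ^ 2 = 1 := by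
    refine List.prod_map_sq_eq_one c ((List.nodup_finRange N).filter _) (fun i hi => ?_)
      fun i hi j hj hij => ?_
    · exact hc i (by simpa using hi)
    · exact (hbc i j (by simpa using hi) (by simpa using hj) hij).2.2.2
  have hI : I = ε 0 * (m • (ta₁ * C) + ta₀ * B) := by
    simp only [I, hB, hd, Finset.mul_sum, hm]
    congr 2
    refine Finset.sum_congr rfl fun i _ => ?_
    rw [← mul_assoc, ← mul_assoc, (hε_comm i ta₀).eq]
  have hI_sq : I ^ 2 = m ^ 2 • ta₁ ^ 2 + m • (ta₁ * ta₀ * (C * B) - ta₁ * ta₀ * (B * C))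
      + ta₀ ^ 2 * B ^ 2 := by
    have hCC : ta₁ * C * (ta₁ * C) = ta₁ ^ 2 := by
      rw [← sq, (h₁ C hC₀ hC₁).mul_pow, hC_sq, mul_one]
    have hBB : ta₀ * B * (ta₀ * B) = ta₀ ^ 2 * B ^ 2 := by
      rw [← sq, (h₀ B hB₀ hB₁).mul_pow]
    have hCB : ta₁ * C * (ta₀ * B) = ta₁ * ta₀ * (C * B) :=
      (h₀ C hC₀ hC₁).symm.mul_mul_mul_comm _ _
    have hBC : ta₀ * B * (ta₁ * C) = -(ta₁ * ta₀ * (B * C)) := by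
      rw [(h₁ B hB₀ hB₁).symm.mul_mul_mul_comm, h_anti, neg_mul]
    rw [hI, (hε_comm 0 _).mul_pow, hε_sq, one_mul, sq, add_mul, mul_add, mul_add,
      smul_mul_smul_comm, smul_mul_assoc, mul_smul_comm, hCC, hBB, hCB, hBC]
    module
  have hQ : ∑ p ∈ Finset.univ.filter
      (fun p : Fin N × Fin N => p.1 ≠ 0 ∧ p.2 ≠ 0 ∧ p.1 < p.2), Q p.1 p.2 ^ 2 =
      m ^ 2 • ta₀ ^ 2 - ta₀ ^ 2 * B ^ 2 := by
    have hpairs : Finset.univ.filter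
        (fun p : Fin N × Fin N => p.1 ≠ 0 ∧ p.2 ≠ 0 ∧ p.1 < p.2) =
        (S ×ˢ S).filter (fun p => p.1 < p.2) := by
      ext p
      simp [hmemS, and_assoc]
    have hterm : ∀ p ∈ (S ×ˢ S).filter (fun p => p.1 < p.2),
        Q p.1 p.2 ^ 2 = ta₀ ^ 2 * (d p.1 - d p.2) ^ 2 := by
      intro p hp
      simp only [Finset.mem_filter, Finset.mem_product] at hp
      obtain ⟨⟨hp₁, hp₂⟩, -⟩ := hp
      exact ((h₀ _ (ha_d _ hp₁).1 (ha_d _ hp₁).2).sub_right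
        (h₀ _ (ha_d _ hp₂).1 (ha_d _ hp₂).2)).mul_pow 2
    rw [hpairs, Finset.sum_congr rfl hterm, ← Finset.mul_sum,
      Finset.sum_lt_sub_sq_of_involutive S d hd_sq hd_comm, hcard, mul_sub, mul_smul_comm,
      mul_one]
  have hT_sq : ∀ j ∈ S, T j ^ 2 =
      (2 : ℝ) • (1 : R) + (ta₁ * ta₀ * (d j * C) - ta₁ * ta₀ * (C * d j)) := by
    intro j hj
    have hj0 := (hmemS j).1 hj
    set D : R := (((List.finRange N).filter fun i => decide (i ≠ 0 ∧ i ≠ j)).map c).prod with hD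
    obtain ⟨hD₀, hD₁⟩ : Commute a₀ D ∧ Commute a₁ D :=
      ha_prod _ fun i hi => (of_decide_eq_true hi).1
    have hcD : Commute (c j) D := by
      refine Commute.list_prod_right _ _ fun x hx => ?_
      obtain ⟨i, hi, rfl⟩ := List.mem_map.1 hx
      have hi' : i ≠ 0 ∧ i ≠ j := by simpa using hi
      exact (hbc j i hj0 hi'.1 hi'.2.symm).2.2.2
    have hdD : Commute (d j) D := by
      refine (hε_comm j D).mul_left (Commute.list_prod_right _ _ fun x hx => ?_)
      obtain ⟨i, hi, rfl⟩ := List.mem_map.1 hx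
      have hi' : i ≠ 0 ∧ i ≠ j := by simpa using hi
      exact (hbc j i hj0 hi'.1 hi'.2.symm).2.1
    have hCD : C = c j * D := by
      have h := List.prod_map_eq_mul_prod_filter_ne c
        (l := (List.finRange N).filter fun i => decide (i ≠ 0))
        ((List.nodup_finRange N).filter _) (j := j) (by simpa using hj0)
        fun i hi hij => (hbc j i hj0 (by simpa using hi) hij.symm).2.2.2
      rw [List.filter_filter] at h
      simp only [C, hD, h]
      congr 4
      funext i
      simp [and_comm]
    have hD_sq : D ^ 2 = 1 := by
      refine List.prod_map_sq_eq_one c ((List.nodup_finRange N).filter _) (fun i hi => ?_)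
        fun i hi k hk hik => ?_
      · have hi' : i ≠ 0 ∧ i ≠ j := by simpa using hi
        exact hc i hi'.1
      · have hi' : i ≠ 0 ∧ i ≠ j := by simpa using hi
        have hk' : k ≠ 0 ∧ k ≠ j := by simpa using hk
        exact (hbc i k hi'.1 hk'.1 hik).2.2.2
    obtain ⟨-, hc₀, -, hc₁⟩ := hab j hj0
    have hT : T j = ε j * (ta₁ * (d j * D) + ta₀ * c j) := by
      have hεd : ε j * d j = b j := by rw [hd, ← mul_assoc, ← sq, hε_sq, one_mul]
      rw [mul_add, ← mul_assoc (ε j) ta₁, (hε_comm j ta₁).eq, mul_assoc ta₁, ← mul_assoc (ε j) (d j),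
        hεd, ← mul_assoc ta₁]
    have hdD₀ : Commute a₀ (d j * D) := (ha_d j hj).1.mul_right hD₀
    have hdD₁ : Commute a₁ (d j * D) := (ha_d j hj).2.mul_right hD₁
    have hdd : ta₁ * (d j * D) * (ta₁ * (d j * D)) = ta₁ ^ 2 := by
      rw [← sq, (h₁ _ hdD₀ hdD₁).mul_pow, hdD.mul_pow, hd_sq j hj, hD_sq, mul_one, mul_one]
    have hcc : ta₀ * c j * (ta₀ * c j) = ta₀ ^ 2 := by
      rw [← sq, (h₀ _ hc₀ hc₁).mul_pow, hc j hj0, mul_one]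
    have hdc : ta₁ * (d j * D) * (ta₀ * c j) = ta₁ * ta₀ * (d j * C) := by
      rw [(h₀ _ hdD₀ hdD₁).symm.mul_mul_mul_comm, hCD, hcD.eq, mul_assoc (d j)]
    have hcd : ta₀ * c j * (ta₁ * (d j * D)) = -(ta₁ * ta₀ * (C * d j)) := by
      rw [(h₁ _ hc₀ hc₁).symm.mul_mul_mul_comm, h_anti, neg_mul, hCD, hdD.eq, mul_assoc (c j)]
    rw [hT, (hε_comm j _).mul_pow, hε_sq, one_mul, sq, add_mul, mul_add, mul_add, hdd, hcc, hdc,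
      hcd, h_sq]
    module
  have hT_sum : ∑ j ∈ S, T j ^ 2 =
      (2 * m) • (1 : R) + (ta₁ * ta₀ * (B * C) - ta₁ * ta₀ * (C * B)) := by
    rw [Finset.sum_congr rfl hT_sq, Finset.sum_add_distrib, Finset.sum_sub_distrib,
      ← Finset.mul_sum, ← Finset.mul_sum, ← Finset.sum_mul, ← Finset.mul_sum, Finset.sum_const,
      ← Nat.cast_smul_eq_nsmul ℝ, hcard, smul_smul, mul_comm m]
  rw [← hm, hQ, hT_sum, sq (_ - I), sub_mul, mul_sub, mul_sub, ← sq I, hI_sq, h_sq]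
  simp only [smul_mul_assoc, mul_smul_comm, one_mul, mul_one]
  module
end

section
/- Let X = !![0, 1; 1, 0], Y = !![0, −Complex.I; Complex.I, 0], Z = !![1, 0; 0, −1] be the Pauli matrices in Matrix (Fin 2) (Fin 2) ℂ, let d ≥ 1, let r₀, r₁, r₂, r₃ be Hermitian d × d complex matrices, and set A = 1 ⊗ r₀ + Z ⊗ r₁ + X ⊗ r₂ + Y ⊗ r₃ (Kronecker products). If A² ≤ 1 in the Loewner order (i.e. 1_{2d} − A² is positive semidefinite), then r₀² + r₁² + r₂² + r₃² ≤ 1_d in the Loewner order; in particular 1_d − r₂² is positive semidefinite. -/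
open Matrix Kronecker
open scoped ComplexOrder

/-- The partial trace over the first tensor factor preserves positive semidefiniteness. -/
theorem Matrix.PosSemidef.sum_submatrix_prodMk {ι n : Type*} [Fintype ι]
    {M : Matrix (ι × n) (ι × n) ℂ} (hM : M.PosSemidef) :
    (∑ i, M.submatrix (Prod.mk i) (Prod.mk i)).PosSemidef :=
  posSemidef_sum _ fun _ _ => hM.submatrix _

/-- The `(i, j)` block of a product is the sum of the products of blocks. -/
theorem Matrix.submatrix_prodMk_mul {ι n R : Type*} [Fintype ι] [Fintype n]
    [NonUnitalNonAssocSemiring R] (M N : Matrix (ι × n) (ι × n) R) (i j : ι) :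
    (M * N).submatrix (Prod.mk i) (Prod.mk j) =
      ∑ k, M.submatrix (Prod.mk i) (Prod.mk k) * N.submatrix (Prod.mk k) (Prod.mk j) := by
  ext a b
  simp [mul_apply, Fintype.sum_prod_type, sum_apply]

/-- The `(i, j)` block of a Kronecker product. -/
theorem Matrix.kronecker_submatrix_prodMk {ι n R : Type*} [Mul R]
    (M : Matrix ι ι R) (N : Matrix n n R) (i j : ι) :
    (M ⊗ₖ N).submatrix (Prod.mk i) (Prod.mk j) = M i j • N :=
  rfl

/-- if `A = 1⊗r₀ + Z⊗r₁ + X⊗r₂ + Y⊗r₃` with Hermitian components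
satisfies `A² ≤ 1` in the Loewner order, then `r₀² + r₁² + r₂² + r₃² ≤ 1`; in
particular `1 − r₂²` is positive semidefinite. -/
theorem pauli_components_sq_le_one
    (d : ℕ) (hd : 1 ≤ d)
    (r₀ r₁ r₂ r₃ : Matrix (Fin d) (Fin d) ℂ)
    (h₀ : r₀.IsHermitian) (h₁ : r₁.IsHermitian)
    (h₂ : r₂.IsHermitian) (h₃ : r₃.IsHermitian)
    (A : Matrix (Fin 2 × Fin d) (Fin 2 × Fin d) ℂ)
    (hA : A = (1 : Matrix (Fin 2) (Fin 2) ℂ) ⊗ₖ r₀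
      + (!![1, 0; 0, -1] : Matrix (Fin 2) (Fin 2) ℂ) ⊗ₖ r₁
      + (!![0, 1; 1, 0] : Matrix (Fin 2) (Fin 2) ℂ) ⊗ₖ r₂
      + (!![0, -Complex.I; Complex.I, 0] : Matrix (Fin 2) (Fin 2) ℂ) ⊗ₖ r₃)
    (hbound : ((1 : Matrix (Fin 2 × Fin d) (Fin 2 × Fin d) ℂ) - A * A).PosSemidef) :
    ((1 : Matrix (Fin d) (Fin d) ℂ) - (r₀ * r₀ + r₁ * r₁ + r₂ * r₂ + r₃ * r₃)).PosSemidef ∧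
    ((1 : Matrix (Fin d) (Fin d) ℂ) - r₂ * r₂).PosSemidef := by
  have hsum : ((1 : Matrix (Fin d) (Fin d) ℂ)
      - (r₀ * r₀ + r₁ * r₁ + r₂ * r₂ + r₃ * r₃)).PosSemidef := by
    have htrace : ∑ i, (1 - A * A).submatrix (Prod.mk i) (Prod.mk i) =
        (2 : ℂ) • (1 - (r₀ * r₀ + r₁ * r₁ + r₂ * r₂ + r₃ * r₃)) := by
      simp only [submatrix_sub, Pi.sub_apply, submatrix_prodMk_mul, Fin.sum_univ_two, hA,
        submatrix_add, Pi.add_apply, kronecker_submatrix_prodMk,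
        submatrix_one _ (Prod.mk_right_injective _)]
      simp only [one_apply_eq, of_apply, cons_val', cons_val_zero, cons_val_one, cons_val_fin_one,
        ne_eq, zero_ne_one, one_ne_zero, not_false_eq_true, one_apply_ne, one_smul, zero_smul,
        neg_smul, add_zero, zero_add, mul_add, add_mul, mul_neg, neg_mul, smul_mul_assoc,
        mul_smul_comm]
      match_scalars <;> ring_nf
      simp
    have hhalf := hbound.sum_submatrix_prodMk.smul (show (0 : ℂ) ≤ 2⁻¹ by positivity)
    rwa [htrace, smul_smul, inv_mul_cancel₀ two_ne_zero, one_smul] at hhalf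
  have hsq {r : Matrix (Fin d) (Fin d) ℂ} (hr : r.IsHermitian) : (r * r).PosSemidef := by
    simpa only [hr.eq] using posSemidef_conjTranspose_mul_self r
  refine ⟨hsum, ?_⟩
  convert hsum.add (((hsq h₀).add (hsq h₁)).add (hsq h₃)) using 1
  abel
end

section
/- Let N ≥ 2 and let l : Fin N → Bool. Define the matrix M_l : Matrix (Fin N → Bool) (Fin N → Bool) ℂ by M_l u v = ε(l 0)·((N−1)·(if v = ¬u then 1 else 0) + (if u = v then ∑_{i ∈ Fin N, i ≠ 0} ε(l i)·ε(u 0)·ε(u i) else 0)). Then for every s : Fin N → Bool, M_l.mulVec φ_s = λ • φ_s, where λ = ε(l 0)·ε(s 0)·((N−1) + ∑_{i ∈ Fin N, i ≠ 0} ε(l i)·ε(s i)). In particular M_l.mulVec φ_l = 2(N−1) • φ_l. -/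
noncomputable section

/-- Sign of a bit: `−1` if `true`, `1` otherwise. -/
def eps (b : Bool) : ℂ := if b then -1 else 1

/-- The GHZ-like vector `φ_s v = (1/√2)·[v = s] + (ε(s 0)/√2)·[v = ¬s]`. -/
def ghz (N : ℕ) [NeZero N] (s : Fin N → Bool) : (Fin N → Bool) → ℂ := fun v =>
  (1 / (Real.sqrt 2 : ℂ)) * (if v = s then 1 else 0) +
  (eps (s 0) / (Real.sqrt 2 : ℂ)) * (if v = (fun i => !(s i)) then 1 else 0)

theorem eps_mul_self (b : Bool) : eps b * eps b = 1 := by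
  cases b <;> simp [eps]

theorem eps_not (b : Bool) : eps (!b) = -eps b := by
  cases b <;> simp [eps]

theorem not_comp_eq_iff {ι : Type*} (u s : ι → Bool) :
    (fun i => !(u i)) = s ↔ u = fun i => !(s i) := by
  constructor <;> rintro rfl <;> simp

/-- Flipping every bit multiplies `φ_s` by `ε(s 0)`: it is an eigenvector of `X^{⊗N}`. -/
theorem ghz_not (N : ℕ) [NeZero N] (s u : Fin N → Bool) :
    ghz N s (fun i => !(u i)) = eps (s 0) * ghz N s u := by
  have h : ((fun i => !(u i)) = fun i => !(s i)) ↔ u = s := by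
    rw [not_comp_eq_iff]; simp
  simp only [ghz, h, not_comp_eq_iff]
  linear_combination (-(1 / (Real.sqrt 2 : ℂ)) * (if u = fun i => !(s i) then 1 else 0)) *
    eps_mul_self (s 0)

/-- `φ_s` is an eigenvector of each `Z_j Z_i`, with eigenvalue `ε(s j)·ε(s i)`. -/
theorem eps_mul_eps_mul_ghz (N : ℕ) [NeZero N] (s u : Fin N → Bool) (j i : Fin N) :
    eps (u j) * eps (u i) * ghz N s u = eps (s j) * eps (s i) * ghz N s u := by
  by_cases h : u = s
  · rw [h]
  by_cases h' : u = fun i => !(s i)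
  · simp [h', eps_not]
  · simp [ghz, h, h']

/-- every GHZ-like vector `φ_s` is an eigenvector of the ideal Bell
operator `M_l` with eigenvalue `ε(l 0)·ε(s 0)·((N−1) + ∑_{i ≠ 0} ε(l i)·ε(s i))`;
in particular `M_l φ_l = 2(N−1)·φ_l`. -/
theorem ideal_bell_operator_eigenvectors
    (N : ℕ) [NeZero N] (hN : 2 ≤ N) (l : Fin N → Bool)
    (M : Matrix (Fin N → Bool) (Fin N → Bool) ℂ)
    (hM : M = Matrix.of fun u v =>
      eps (l 0) * (((N : ℂ) - 1) * (if v = (fun i => !(u i)) then 1 else 0) +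
        (if u = v then
          ∑ i ∈ Finset.univ.filter (fun i : Fin N => i ≠ 0),
            eps (l i) * eps (u 0) * eps (u i)
        else 0))) :
    (∀ s : Fin N → Bool,
      M.mulVec (ghz N s) =
        (eps (l 0) * eps (s 0) * (((N : ℂ) - 1) +
          ∑ i ∈ Finset.univ.filter (fun i : Fin N => i ≠ 0),
            eps (l i) * eps (s i))) • ghz N s) ∧
    M.mulVec (ghz N l) = (2 * ((N : ℂ) - 1)) • ghz N l := by
  have key : ∀ s : Fin N → Bool, M.mulVec (ghz N s) =
      (eps (l 0) * eps (s 0) * (((N : ℂ) - 1) +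
        ∑ i ∈ Finset.univ.filter (fun i : Fin N => i ≠ 0),
          eps (l i) * eps (s i))) • ghz N s := by
    intro s
    ext u
    have hsum : (∑ i ∈ Finset.univ.filter (fun i : Fin N => i ≠ 0),
          eps (l i) * eps (u 0) * eps (u i)) * ghz N s u =
        eps (s 0) * (∑ i ∈ Finset.univ.filter (fun i : Fin N => i ≠ 0),
          eps (l i) * eps (s i)) * ghz N s u := by
      rw [Finset.mul_sum, Finset.sum_mul, Finset.sum_mul]
      refine Finset.sum_congr rfl fun i _ => ?_
      linear_combination eps (l i) * eps_mul_eps_mul_ghz N s u 0 i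
    have hentry : M.mulVec (ghz N s) u =
        eps (l 0) * (((N : ℂ) - 1) * ghz N s (fun i => !(u i)) +
          (∑ i ∈ Finset.univ.filter (fun i : Fin N => i ≠ 0),
            eps (l i) * eps (u 0) * eps (u i)) * ghz N s u) := by
      simp only [hM, Matrix.mulVec, dotProduct, Matrix.of_apply, mul_assoc, add_mul,
        ← Finset.mul_sum, Finset.sum_add_distrib, ite_mul, one_mul, zero_mul,
        Finset.sum_ite_eq, Finset.sum_ite_eq', Finset.mem_univ, if_true]
    rw [hentry, hsum, ghz_not, Pi.smul_apply, smul_eq_mul]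
    ring
  refine ⟨key, ?_⟩
  rw [key l]
  congr 1
  have hcard : ((Finset.univ.filter (fun i : Fin N => i ≠ 0)).card : ℂ) = (N : ℂ) - 1 := by
    rw [Finset.filter_ne', Finset.card_erase_of_mem (Finset.mem_univ _), Finset.card_univ,
      Fintype.card_fin, Nat.cast_sub (by lia), Nat.cast_one]
  simp only [eps_mul_self, Finset.sum_const, nsmul_eq_mul, hcard]
  ring
end
end

section
/- Let N ≥ 2 and let l, s : Fin N → Bool with s ≠ l. Then, as integers, ε(l 0)·ε(s 0)·((N−1) + ∑_{i ∈ Fin N, i ≠ 0} ε(l i)·ε(s i)) ≤ 2·(N−1) − 2. -/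
/-- Integer sign of a bit: `−1` if `true`, `1` otherwise. -/
def epsZ (b : Bool) : ℤ := if b then -1 else 1

theorem epsZ_mul_self (a : Bool) : epsZ a * epsZ a = 1 := by
  cases a <;> simp [epsZ]

theorem epsZ_mul_of_ne {a b : Bool} (h : a ≠ b) : epsZ a * epsZ b = -1 := by
  cases a <;> cases b <;> simp_all [epsZ]

theorem epsZ_mul_le_one (a b : Bool) : epsZ a * epsZ b ≤ 1 := by
  cases a <;> cases b <;> simp [epsZ]

theorem neg_one_le_epsZ_mul (a b : Bool) : -1 ≤ epsZ a * epsZ b := by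
  cases a <;> cases b <;> simp [epsZ]

theorem neg_card_le_sum_epsZ_mul {ι : Type*} (t : Finset ι) (l s : ι → Bool) :
    -(t.card : ℤ) ≤ ∑ i ∈ t, epsZ (l i) * epsZ (s i) := by
  simpa using t.card_nsmul_le_sum (fun i => epsZ (l i) * epsZ (s i)) (-1)
    fun i _ => neg_one_le_epsZ_mul (l i) (s i)

theorem sum_epsZ_mul_le_card_sub_two {ι : Type*} {t : Finset ι} {l s : ι → Bool} {j : ι}
    (hj : j ∈ t) (h : l j ≠ s j) :
    ∑ i ∈ t, epsZ (l i) * epsZ (s i) ≤ (t.card : ℤ) - 2 := by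
  classical
  have hrest := (t.erase j).sum_le_card_nsmul (fun i => epsZ (l i) * epsZ (s i)) 1
    fun i _ => epsZ_mul_le_one (l i) (s i)
  have hcard := Finset.card_erase_add_one hj
  rw [← Finset.add_sum_erase t _ hj, epsZ_mul_of_ne h]
  simp only [nsmul_eq_mul, mul_one] at hrest
  lia

/-- spectral gap of the ideal Bell operator: for `s ≠ l` the eigenvalue
`ε(l 0)·ε(s 0)·((N−1) + ∑_{i ≠ 0} ε(l i)·ε(s i))` is at most `2(N−1) − 2`. -/
theorem ideal_bell_operator_spectral_gap
    (N : ℕ) [NeZero N] (hN : 2 ≤ N) (l s : Fin N → Bool) (hs : s ≠ l) :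
    epsZ (l 0) * epsZ (s 0) * (((N : ℤ) - 1) +
      ∑ i ∈ Finset.univ.filter (fun i : Fin N => i ≠ 0), epsZ (l i) * epsZ (s i))
    ≤ 2 * ((N : ℤ) - 1) - 2 := by
  have hcard : (Finset.univ.filter (fun i : Fin N => i ≠ 0)).card = N - 1 := by
    simp [Finset.filter_ne']
  by_cases h0 : l 0 = s 0
  · obtain ⟨j, hj⟩ := Function.ne_iff.mp hs
    have hj0 : j ≠ 0 := by
      rintro rfl
      exact hj h0.symm
    have hsum := sum_epsZ_mul_le_card_sub_two
      (t := Finset.univ.filter (fun i : Fin N => i ≠ 0)) (by simpa using hj0) hj.symm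
    rw [h0, epsZ_mul_self]
    lia
  · have hsum := neg_card_le_sum_epsZ_mul (Finset.univ.filter (fun i : Fin N => i ≠ 0)) l s
    rw [epsZ_mul_of_ne h0]
    lia
end

section
/- Let N ≥ 2 and let j₁, j₂ ∈ Fin N with j₁ ≠ j₂. Define O : Matrix (Fin N → Bool) (Fin N → Bool) ℂ by O u v = ∏_{i ∈ Fin N} m_i (u i) (v i), where m_i is the Pauli Y matrix if i ∈ {j₁, j₂} and the Pauli X matrix otherwise. Then ⟨φ₀, O.mulVec φ₀⟩ = −1, where φ₀ is the N-qubit GHZ state (the GHZ-like vector for the constant-false string). -/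
noncomputable section

/-- The Pauli `X` matrix with qubit index `Bool`. -/
def PauliX : Matrix Bool Bool ℂ := Matrix.of fun u v => if v = !u then 1 else 0

/-- The Pauli `Y` matrix with qubit index `Bool`. -/
def PauliY : Matrix Bool Bool ℂ := Matrix.of fun u v =>
  if u = false ∧ v = true then -Complex.I
  else if u = true ∧ v = false then Complex.I else 0

theorem ghz_false_apply (N : ℕ) [NeZero N] (v : Fin N → Bool) :
    ghz N (fun _ => false) v = (1 / (Real.sqrt 2 : ℂ)) *
      ((if v = fun _ => false then 1 else 0) + (if v = fun _ => true then 1 else 0)) := by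
  simp [ghz, eps, mul_add]

theorem sum_mul_ghz_false (N : ℕ) [NeZero N] (g : (Fin N → Bool) → ℂ) :
    ∑ v, g v * ghz N (fun _ => false) v =
      (1 / (Real.sqrt 2 : ℂ)) * (g (fun _ => false) + g (fun _ => true)) := by
  have h (v : Fin N → Bool) : g v * ghz N (fun _ => false) v = (1 / (Real.sqrt 2 : ℂ)) *
      ((if v = fun _ => false then g v else 0) + (if v = fun _ => true then g v else 0)) := by
    rw [ghz_false_apply]
    split_ifs <;> ring
  simp_rw [h, ← Finset.mul_sum, Finset.sum_add_distrib, Finset.sum_ite_eq' Finset.univ,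
    Finset.mem_univ, if_true]

theorem conj_ghz_false (N : ℕ) [NeZero N] (v : Fin N → Bool) :
    (starRingEnd ℂ) (ghz N (fun _ => false) v) = ghz N (fun _ => false) v := by
  rw [ghz_false_apply]
  split_ifs <;> simp

theorem sum_conj_ghz_false_mul_mulVec (N : ℕ) [NeZero N]
    (A : Matrix (Fin N → Bool) (Fin N → Bool) ℂ) :
    ∑ v, (starRingEnd ℂ) (ghz N (fun _ => false) v) * (A.mulVec (ghz N (fun _ => false))) v =
      (1 / 2) * (A (fun _ => false) (fun _ => false) + A (fun _ => false) (fun _ => true) +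
        A (fun _ => true) (fun _ => false) + A (fun _ => true) (fun _ => true)) := by
  have hs : (1 / (Real.sqrt 2 : ℂ)) * (1 / (Real.sqrt 2 : ℂ)) = 1 / 2 := by
    rw [div_mul_div_comm, ← Complex.ofReal_mul, Real.mul_self_sqrt zero_le_two]
    norm_num
  simp_rw [conj_ghz_false, mul_comm (ghz N _ _), Matrix.mulVec, dotProduct]
  simp_rw [sum_mul_ghz_false]
  rw [← mul_add, ← mul_assoc, hs]
  ring

theorem prod_pauliY_pauliX_self {ι : Type*} [Fintype ι] [DecidableEq ι] (i₀ j₁ j₂ : ι) (b : Bool) :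
    ∏ i, (if i = j₁ ∨ i = j₂ then PauliY else PauliX) b b = 0 := by
  refine Finset.prod_eq_zero (Finset.mem_univ i₀) ?_
  cases b <;> split_ifs <;> simp [PauliX, PauliY]

theorem prod_pauliY_pauliX_of_ne {ι : Type*} [Fintype ι] [DecidableEq ι] {j₁ j₂ : ι}
    (hj : j₁ ≠ j₂) {b c : Bool} (hbc : b ≠ c) :
    ∏ i, (if i = j₁ ∨ i = j₂ then PauliY else PauliX) b c = -1 := by
  obtain rfl : c = !b := Bool.eq_not.mpr hbc.symm
  rw [Fintype.prod_eq_mul j₁ j₂ hj]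
  · cases b <;> simp [PauliY]
  · rintro i ⟨h₁, h₂⟩
    simp [h₁, h₂, PauliX]

/-- the GHZ correlator of the tensor observable with Pauli `Y` at two
sites `j₁ ≠ j₂` and Pauli `X` at all other sites equals `−1`. -/
theorem ghz_two_Y_correlator
    (N : ℕ) [NeZero N] (hN : 2 ≤ N) (j₁ j₂ : Fin N) (hj : j₁ ≠ j₂)
    (O : Matrix (Fin N → Bool) (Fin N → Bool) ℂ)
    (hO : O = Matrix.of fun u v =>
      ∏ i, (if i = j₁ ∨ i = j₂ then PauliY else PauliX) (u i) (v i)) :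
    ∑ v, (starRingEnd ℂ) (ghz N (fun _ => false) v) *
      (O.mulVec (ghz N (fun _ => false))) v = -1 := by
  rw [sum_conj_ghz_false_mul_mulVec, hO]
  simp only [Matrix.of_apply]
  rw [prod_pauliY_pauliX_self 0, prod_pauliY_pauliX_self 0, prod_pauliY_pauliX_of_ne hj (by decide),
    prod_pauliY_pauliX_of_ne hj (by decide)]
  norm_num
end
end

section
/- Let N ≥ 2. For distinct j₁, j₂ ∈ Fin N define O_{j₁ j₂} : Matrix (Fin N → Bool) (Fin N → Bool) ℂ by O_{j₁ j₂} u v = ∏_{i ∈ Fin N} m_i (u i) (v i), where m_i is the Pauli Y matrix if i ∈ {j₁, j₂} and the Pauli X matrix otherwise. Then the ideal value of the rescaled Mermin functional on the N-qubit GHZ state equals 1: −(2 / (N·(N−1))) · ∑_{j₁ < j₂} ⟨φ₀, O_{j₁ j₂}.mulVec φ₀⟩ = 1, where the sum runs over unordered pairs of distinct indices of Fin N. -/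
noncomputable section

theorem sum_ghz_mul (N : ℕ) [NeZero N] (f : (Fin N → Bool) → ℂ) :
    ∑ v, ghz N (fun _ => false) v * f v =
      (1 / (Real.sqrt 2 : ℂ)) * (f (fun _ => false) + f (fun _ => true)) := by
  simp [ghz, eps, add_mul, mul_add, Finset.sum_add_distrib]

/-- The entries of a Pauli string with two `Y`s and otherwise `X`s at constant bit strings. -/
theorem prod_pauli_const {ι : Type*} [Fintype ι] [DecidableEq ι] {j k : ι} (hjk : j ≠ k)
    (c d : Bool) :
    ∏ i, (if i = j ∨ i = k then PauliY else PauliX) c d = if c = d then 0 else -1 := by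
  split_ifs with h
  · refine Finset.prod_eq_zero (Finset.mem_univ j) ?_
    subst h
    cases c <;> simp [PauliY]
  · have hX : PauliX c d = 1 := by cases c <;> cases d <;> simp_all [PauliX]
    have hY : PauliY c d * PauliY c d = -1 := by cases c <;> cases d <;> simp_all [PauliY]
    rw [← hY, ← Finset.prod_subset (Finset.subset_univ {j, k}), Finset.prod_pair hjk]
    · simp
    · intro i _ hi
      have hi' : ¬(i = j ∨ i = k) := by simpa using hi
      rw [if_neg hi', hX]

theorem ghz_expectation_pauli (N : ℕ) [NeZero N] {j k : Fin N} (hjk : j ≠ k) :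
    ∑ v, (starRingEnd ℂ) (ghz N (fun _ => false) v) *
      ((Matrix.of fun u v =>
        ∏ i, (if i = j ∨ i = k then PauliY else PauliX) (u i) (v i)).mulVec
          (ghz N (fun _ => false))) v = -1 := by
  have h2 : (Real.sqrt 2 : ℂ) * (Real.sqrt 2 : ℂ) = 2 := by
    rw [← Complex.ofReal_mul, Real.mul_self_sqrt (by norm_num)]
    norm_num
  have h0 : (Real.sqrt 2 : ℂ) ≠ 0 := by
    intro h
    simp [h] at h2
  simp only [conj_ghz_false, sum_ghz_mul, Matrix.mulVec, dotProduct, Matrix.of_apply]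
  simp only [mul_comm _ (ghz N _ _), sum_ghz_mul, prod_pauli_const hjk]
  simp only [if_true, if_false, reduceCtorEq]
  field_simp
  linear_combination h2

theorem card_filter_fst_lt_snd (N : ℕ) :
    (Finset.univ.filter (fun p : Fin N × Fin N => p.1 < p.2)).card = N.choose 2 := by
  rw [Finset.card_filter, Fintype.sum_prod_type_right]
  simp only [← Finset.card_filter, Finset.filter_gt_eq_Iio, Fin.card_Iio]
  rw [Fin.sum_univ_eq_sum_range (fun i => i), Finset.sum_range_id, Nat.choose_two_right]

/-- the ideal value of the rescaled Mermin functional on the `N`-qubit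
GHZ state is `1`:
`−(2/(N(N−1)))·∑_{j₁ < j₂} ⟨φ₀, O_{j₁ j₂} φ₀⟩ = 1`, where `O_{j₁ j₂}` has Pauli `Y`
at sites `j₁, j₂` and Pauli `X` elsewhere. -/
theorem mermin_cqt_value
    (N : ℕ) [NeZero N] (hN : 2 ≤ N) :
    -(2 / ((N : ℂ) * ((N : ℂ) - 1))) *
      ∑ p ∈ Finset.univ.filter (fun p : Fin N × Fin N => p.1 < p.2),
        ∑ v, (starRingEnd ℂ) (ghz N (fun _ => false) v) *
          ((Matrix.of fun u v =>
            ∏ i, (if i = p.1 ∨ i = p.2 then PauliY else PauliX) (u i) (v i)).mulVec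
              (ghz N (fun _ => false))) v
    = 1 := by
  rw [Finset.sum_congr rfl fun p hp =>
    ghz_expectation_pauli N (ne_of_lt (Finset.mem_filter.mp hp).2)]
  have hN0 : (N : ℂ) ≠ 0 := NeZero.ne _
  have hN1 : (N : ℂ) - 1 ≠ 0 := by
    rw [sub_ne_zero]
    exact_mod_cast (by lia : N ≠ 1)
  rw [Finset.sum_const, card_filter_fst_lt_snd, nsmul_eq_mul, Nat.cast_choose_two]
  field_simp
end
end

section
/- Let N ≥ 3 and let j₁, j₂ ∈ Fin N be distinct. Let a, b : Fin 4 → ℂ and set A = a₀·1 + a₁·Z + a₂·X + a₃·Y and B = b₀·1 + b₁·Z + b₂·X + b₃·Y as 2 × 2 complex matrices (1 the identity, X, Y, Z the Pauli matrices). Define O : Matrix (Fin N → Bool) (Fin N → Bool) ℂ by O u v = A (u j₁) (v j₁) · B (u j₂) (v j₂) · ∏_{i ≠ j₁, j₂} X (u i) (v i). Then ⟨φ₀, O.mulVec φ₀⟩ = a₂·b₂ − a₃·b₃. -/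
noncomputable section

/-- The Pauli `Z` matrix with qubit index `Bool`. -/
def PauliZ : Matrix Bool Bool ℂ := Matrix.of fun u v => if u = v then eps u else 0

/-- The expectation of an operator in `φ₀` is the average of its four corner entries. -/
theorem ghz_false_expectation (N : ℕ) [NeZero N]
    (M : Matrix (Fin N → Bool) (Fin N → Bool) ℂ) :
    ∑ v, (starRingEnd ℂ) (ghz N (fun _ => false) v) * (M.mulVec (ghz N (fun _ => false))) v =
      (M (fun _ => false) (fun _ => false) + M (fun _ => false) (fun _ => true) +
        M (fun _ => true) (fun _ => false) + M (fun _ => true) (fun _ => true)) / 2 := by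
  have hs : ((Real.sqrt 2 : ℂ))⁻¹ * ((Real.sqrt 2 : ℂ))⁻¹ = 1 / 2 := by
    rw [← mul_inv, ← Complex.ofReal_mul, Real.mul_self_sqrt (by norm_num)]
    norm_num
  simp only [ghz, eps, Matrix.mulVec, dotProduct, Bool.not_false, Bool.false_eq_true, if_false,
    one_div, map_add, map_inv₀, Complex.conj_ofReal, apply_ite (starRingEnd ℂ),
    map_zero, mul_add, add_mul, Finset.sum_add_distrib, mul_ite, ite_mul, mul_one, mul_zero,
    zero_mul, Finset.sum_ite_eq', Finset.mem_univ, if_true]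
  linear_combination
    (M (fun _ => false) (fun _ => false) + M (fun _ => false) (fun _ => true) +
      M (fun _ => true) (fun _ => false) + M (fun _ => true) (fun _ => true)) * hs

/-- The entries of an `X`-string between constant bit strings. -/
theorem prod_pauliX_const {ι : Type*} (S : Finset ι) (hS : S.Nonempty) (p q : Bool) :
    ∏ _i ∈ S, PauliX p q = if q = !p then 1 else 0 := by
  rw [Finset.prod_const, PauliX, Matrix.of_apply, ite_pow, one_pow,
    zero_pow hS.card_pos.ne']

/-- a GHZ correlator with arbitrary single-qubit observables
`A = a₀·1 + a₁·Z + a₂·X + a₃·Y` and `B = b₀·1 + b₁·Z + b₂·X + b₃·Y` at two distinct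
sites and Pauli `X` at all other sites equals `a₂·b₂ − a₃·b₃`. -/
theorem ghz_correlator_two_general_sites
    (N : ℕ) [NeZero N] (hN : 3 ≤ N) (j₁ j₂ : Fin N) (hj : j₁ ≠ j₂)
    (a b : Fin 4 → ℂ) (A B : Matrix Bool Bool ℂ)
    (hA : A = a 0 • (1 : Matrix Bool Bool ℂ) + a 1 • PauliZ + a 2 • PauliX + a 3 • PauliY)
    (hB : B = b 0 • (1 : Matrix Bool Bool ℂ) + b 1 • PauliZ + b 2 • PauliX + b 3 • PauliY)
    (O : Matrix (Fin N → Bool) (Fin N → Bool) ℂ)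
    (hO : O = Matrix.of fun u v =>
      A (u j₁) (v j₁) * B (u j₂) (v j₂) *
        ∏ i ∈ Finset.univ.filter (fun i : Fin N => i ≠ j₁ ∧ i ≠ j₂),
          PauliX (u i) (v i)) :
    ∑ v, (starRingEnd ℂ) (ghz N (fun _ => false) v) *
      (O.mulVec (ghz N (fun _ => false))) v = a 2 * b 2 - a 3 * b 3 := by
  have hS : (Finset.univ.filter (fun i : Fin N => i ≠ j₁ ∧ i ≠ j₂)).Nonempty := by
    obtain ⟨k, -, hk⟩ := Finset.exists_mem_notMem_of_card_lt_card
      (s := {j₁, j₂}) (t := (Finset.univ : Finset (Fin N)))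
      (by rw [Finset.card_pair hj, Finset.card_fin]; omega)
    exact ⟨k, by simpa using hk⟩
  rw [ghz_false_expectation, hO]
  simp only [Matrix.of_apply, prod_pauliX_const _ hS]
  simp only [hA, hB, PauliX, PauliY, PauliZ, Matrix.add_apply, Matrix.smul_apply,
    Matrix.one_apply, Matrix.of_apply, smul_eq_mul]
  simp
  linear_combination a 3 * b 3 * Complex.I_mul_I
end
end

section
/- Let N ≥ 2. For each j ∈ Fin N let d_j ≥ 1, let r_{j,2}, r_{j,3} be Hermitian d_j × d_j complex matrices with r_{j,2}* = r_{j,2} (entrywise real), r_{j,3}* = −r_{j,3} (entrywise anti-real), and 1 − r_{j,2}² positive semidefinite, and let ρ_j be a positive semidefinite d_j × d_j complex matrix with Tr ρ_j = 1 and ρ_j* = ρ_j. Then −(1 / (N·(N−1))) · ∑_{j₁ ≠ j₂} re( Tr(r_{j₁,2}·ρ_{j₁})·Tr(r_{j₂,2}·ρ_{j₂}) − Tr(r_{j₁,3}·ρ_{j₁})·Tr(r_{j₂,3}·ρ_{j₂}) ) ≤ 1 / (N−1), where the sum runs over ordered pairs (j₁, j₂) with j₁ ≠ j₂. -/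
open scoped ComplexOrder

namespace Matrix

variable {n : Type*}

theorem IsHermitian.transpose_eq_map_conj {A : Matrix n n ℂ} (hA : A.IsHermitian) :
    Aᵀ = A.map (starRingEnd ℂ) := by
  ext i j
  exact (hA.apply j i).symm

variable [Fintype n]

theorem PosSemidef.trace_mul_nonneg [DecidableEq n] {A B : Matrix n n ℂ}
    (hA : A.PosSemidef) (hB : B.PosSemidef) : 0 ≤ (A * B).trace := by
  obtain ⟨C, rfl⟩ : ∃ C : Matrix n n ℂ, B = Cᴴ * C := by
    open scoped MatrixOrder in
    exact CStarAlgebra.nonneg_iff_eq_star_mul_self.mp hB.nonneg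
  rw [← mul_assoc, trace_mul_comm, ← mul_assoc]
  exact (hA.mul_mul_conjTranspose_same C).trace_nonneg

/-- An entrywise anti-real Hermitian observable has vanishing expectation in a real state. -/
theorem IsHermitian.trace_mul_eq_zero_of_antireal {A B : Matrix n n ℂ}
    (hA : A.IsHermitian) (hB : B.IsHermitian) (hA' : A.map (starRingEnd ℂ) = -A)
    (hB' : B.map (starRingEnd ℂ) = B) : (A * B).trace = 0 := by
  rw [← self_eq_neg]
  calc (A * B).trace = (Bᵀ * Aᵀ).trace := by rw [← transpose_mul, trace_transpose]
    _ = -(A * B).trace := by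
      rw [hA.transpose_eq_map_conj, hB.transpose_eq_map_conj, hA', hB', mul_neg, trace_neg,
        trace_mul_comm]

theorem IsHermitian.ofReal_re_trace_mul {A B : Matrix n n ℂ}
    (hA : A.IsHermitian) (hB : B.IsHermitian) :
    ((A * B).trace.re : ℂ) = (A * B).trace := by
  apply Complex.conj_eq_iff_re.mp
  rw [starRingEnd_apply, ← trace_conjTranspose, conjTranspose_mul, hA.eq, hB.eq, trace_mul_comm]

/-- The expectation of a Hermitian observable with `A² ≤ 1` in a state has square at most one. -/
theorem IsHermitian.sq_re_trace_mul_le_one [DecidableEq n] {A B : Matrix n n ℂ}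
    (hA : A.IsHermitian) (hA' : (1 - A * A).PosSemidef) (hB : B.PosSemidef)
    (hB' : B.trace = 1) : (A * B).trace.re ^ 2 ≤ 1 := by
  set t := (A * B).trace.re
  have htC : (t : ℂ) = (A * B).trace := hA.ofReal_re_trace_mul hB.isHermitian
  have h₁ : 0 ≤ ((1 - A * A) * B).trace := hA'.trace_mul_nonneg hB
  have h₂ : 0 ≤ (((A - (t : ℂ) • 1)ᴴ * (A - (t : ℂ) • 1)) * B).trace :=
    (posSemidef_conjTranspose_mul_self _).trace_mul_nonneg hB
  have e : (((A - (t : ℂ) • 1)ᴴ * (A - (t : ℂ) • 1)) * B).trace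
      = (A * A * B).trace - (t : ℂ) ^ 2 := by
    simp only [conjTranspose_sub, hA.eq, conjTranspose_smul, conjTranspose_one, RCLike.star_def,
      Complex.conj_ofReal, sub_mul, mul_sub, smul_mul_assoc, mul_smul_comm, one_mul, mul_one,
      trace_sub, trace_smul, smul_eq_mul, hB', ← htC]
    ring
  rw [sub_mul, one_mul, trace_sub, hB'] at h₁
  rw [e] at h₂
  have h := add_nonneg h₁ h₂
  rw [sub_add_sub_cancel, sub_nonneg] at h
  exact_mod_cast h

end Matrix

theorem Finset.neg_card_le_sum_offDiag_mul {ι : Type*} [Fintype ι] [DecidableEq ι] (t : ι → ℝ)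
    (ht : ∀ i, t i ^ 2 ≤ 1) :
    -(Fintype.card ι : ℝ) ≤ ∑ p ∈ univ.filter (fun p : ι × ι => p.1 ≠ p.2), t p.1 * t p.2 := by
  have hsplit := sum_filter_add_sum_filter_not univ (fun p : ι × ι => p.1 = p.2)
    (fun p => t p.1 * t p.2)
  have hdiag : ∑ p ∈ univ.filter (fun p : ι × ι => p.1 = p.2), t p.1 * t p.2 = ∑ i, t i ^ 2 := by
    rw [sum_filter, Fintype.sum_prod_type]
    simp [sq]
  have hall : ∑ p : ι × ι, t p.1 * t p.2 = (∑ i, t i) ^ 2 := by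
    rw [Fintype.sum_prod_type, sq, sum_mul_sum]
  have hle : ∑ i, t i ^ 2 ≤ Fintype.card ι := by
    simpa using sum_le_sum fun i (_ : i ∈ univ) => ht i
  linarith [sq_nonneg (∑ i, t i)]

/-- the real-quantum-theory bound `β_RQT = 1/(N−1)` for the rescaled
Mermin functional: with `r_{j,2}` Hermitian real and norm-bounded, `r_{j,3}` Hermitian
anti-real, and `ρ_j` real states,
`−(1/(N(N−1)))·∑_{j₁ ≠ j₂} re(Tr(r_{j₁,2}ρ_{j₁})Tr(r_{j₂,2}ρ_{j₂}) −
Tr(r_{j₁,3}ρ_{j₁})Tr(r_{j₂,3}ρ_{j₂})) ≤ 1/(N−1)`. -/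
theorem rqt_bound
    (N : ℕ) (hN : 2 ≤ N) (d : Fin N → ℕ) (hd : ∀ j, 1 ≤ d j)
    (r₂ r₃ ρ : ∀ j, Matrix (Fin (d j)) (Fin (d j)) ℂ)
    (hr₂H : ∀ j, (r₂ j).IsHermitian) (hr₃H : ∀ j, (r₃ j).IsHermitian)
    (hr₂R : ∀ j, (r₂ j).map (starRingEnd ℂ) = r₂ j)
    (hr₃A : ∀ j, (r₃ j).map (starRingEnd ℂ) = -(r₃ j))
    (hr₂b : ∀ j, ((1 : Matrix (Fin (d j)) (Fin (d j)) ℂ) - r₂ j * r₂ j).PosSemidef)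
    (hρ : ∀ j, (ρ j).PosSemidef) (hρTr : ∀ j, (ρ j).trace = 1)
    (hρR : ∀ j, (ρ j).map (starRingEnd ℂ) = ρ j) :
    -(1 / ((N : ℝ) * ((N : ℝ) - 1))) *
      ∑ p ∈ Finset.univ.filter (fun p : Fin N × Fin N => p.1 ≠ p.2),
        ((r₂ p.1 * ρ p.1).trace * (r₂ p.2 * ρ p.2).trace -
         (r₃ p.1 * ρ p.1).trace * (r₃ p.2 * ρ p.2).trace).re
    ≤ 1 / ((N : ℝ) - 1) := by
  have hN' : (2 : ℝ) ≤ N := by exact_mod_cast hN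
  have hsum : ∀ p : Fin N × Fin N,
      ((r₂ p.1 * ρ p.1).trace * (r₂ p.2 * ρ p.2).trace -
        (r₃ p.1 * ρ p.1).trace * (r₃ p.2 * ρ p.2).trace).re
      = (r₂ p.1 * ρ p.1).trace.re * (r₂ p.2 * ρ p.2).trace.re := fun p => by
    rw [(hr₃H p.1).trace_mul_eq_zero_of_antireal (hρ p.1).isHermitian (hr₃A _) (hρR _),
      zero_mul, sub_zero, ← (hr₂H p.1).ofReal_re_trace_mul (hρ p.1).isHermitian,
      Complex.re_ofReal_mul, Complex.ofReal_re]
  have hS := Finset.neg_card_le_sum_offDiag_mul (fun j => (r₂ j * ρ j).trace.re)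
    fun j => (hr₂H j).sq_re_trace_mul_le_one (hr₂b j) (hρ j) (hρTr j)
  rw [Fintype.card_fin] at hS
  have hN₁ : (0 : ℝ) < (N : ℝ) - 1 := by linarith
  simp only [hsum]
  rw [neg_mul, ← mul_neg]
  calc _ ≤ 1 / ((N : ℝ) * ((N : ℝ) - 1)) * N := by gcongr; linarith
    _ = 1 / ((N : ℝ) - 1) := by field_simp
end

section
/- Let ι be a finite type, let (e_s)_{s ∈ ι} be vectors in (ι' → ℂ) (ι' a finite type) forming an orthonormal basis for the standard inner product, let T : Matrix ι' ι' ℂ satisfy T.mulVec e_s = λ_s • e_s with λ_s ∈ ℝ for every s ∈ ι, indexed so that the family (e_s) is indexed by the same finite type. Fix s₀ ∈ ι, β ∈ ℝ and g > 0 such that |β − λ_s| ≥ g for every s ≠ s₀. If ψ : ι' → ℂ satisfies ‖β • ψ − T.mulVec ψ‖ ≤ η (Euclidean norm), then ∑_{s ≠ s₀} ‖⟨e_s, ψ⟩‖² ≤ η² / g². -/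
open scoped InnerProductSpace in
theorem OrthonormalBasis.inner_map_of_eigenvectors {ι E : Type*} [Fintype ι]
    [NormedAddCommGroup E] [InnerProductSpace ℂ E] (b : OrthonormalBasis ι ℂ E)
    (L : E →ₗ[ℂ] E) (μ : ι → ℂ) (hL : ∀ s, L (b s) = μ s • b s) (x : E) (s : ι) :
    ⟪b s, L x⟫_ℂ = μ s * ⟪b s, x⟫_ℂ := by
  classical
  conv_lhs => rw [← b.sum_repr' x]
  simp [hL, b.inner_eq_ite, mul_comm]

open scoped InnerProductSpace in
/-- The weight of `x` on the eigenvectors of `L` whose eigenvalue is at distance at least `g`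
from `β` is controlled by the residual `β • x - L x`. -/
theorem OrthonormalBasis.sq_mul_sum_norm_inner_le {ι E : Type*} [Fintype ι]
    [NormedAddCommGroup E] [InnerProductSpace ℂ E] (b : OrthonormalBasis ι ℂ E)
    (L : E →ₗ[ℂ] E) (μ : ι → ℂ) (hL : ∀ s, L (b s) = μ s • b s) (S : Finset ι)
    (β : ℂ) {g : ℝ} (hg : 0 ≤ g) (hgap : ∀ s ∈ S, g ≤ ‖β - μ s‖) (x : E) :
    g ^ 2 * ∑ s ∈ S, ‖⟪b s, x⟫_ℂ‖ ^ 2 ≤ ‖β • x - L x‖ ^ 2 := by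
  calc g ^ 2 * ∑ s ∈ S, ‖⟪b s, x⟫_ℂ‖ ^ 2
      ≤ ∑ s ∈ S, ‖⟪b s, β • x - L x⟫_ℂ‖ ^ 2 := by
        rw [Finset.mul_sum]
        refine Finset.sum_le_sum fun s hs => ?_
        rw [inner_sub_right, inner_smul_right, b.inner_map_of_eigenvectors L μ hL, ← sub_mul,
          norm_mul, mul_pow]
        gcongr
        exact hgap s hs
    _ ≤ ‖β • x - L x‖ ^ 2 := b.orthonormal.sum_inner_products_le _


/-- quantitative spectral-gap estimate. If `(e s)` is an orthonormal
basis of eigenvectors of `T` with real eigenvalues `lam s`, all eigenvalues except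
`lam s₀` are at distance at least `g > 0` from `β`, and `‖β•ψ − Tψ‖ ≤ η`, then the
weight of `ψ` outside `e s₀` satisfies `∑_{s ≠ s₀} |⟨e s, ψ⟩|² ≤ η²/g²`. -/
theorem spectral_gap_estimate
    {ι ι' : Type*} [Fintype ι] [Fintype ι'] [DecidableEq ι]
    (e : ι → (ι' → ℂ))
    (horth : ∀ s t, (∑ v, (starRingEnd ℂ) (e s v) * e t v) = if s = t then 1 else 0)
    (hcard : Fintype.card ι = Fintype.card ι')
    (T : Matrix ι' ι' ℂ) (lam : ι → ℝ)
    (hT : ∀ s, T.mulVec (e s) = (lam s : ℂ) • e s)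
    (s₀ : ι) (β g : ℝ) (hg : 0 < g)
    (hgap : ∀ s, s ≠ s₀ → g ≤ |β - lam s|)
    (ψ : ι' → ℂ) (η : ℝ)
    (hψ : ‖(WithLp.equiv 2 (ι' → ℂ)).symm (β • ψ - T.mulVec ψ)‖ ≤ η) :
    ∑ s ∈ Finset.univ.filter (fun s => s ≠ s₀),
      ‖∑ v, (starRingEnd ℂ) (e s v) * ψ v‖ ^ 2 ≤ η ^ 2 / g ^ 2 := by
  have hinner (s : ι) (φ : ι' → ℂ) : inner ℂ (WithLp.toLp 2 (e s)) (WithLp.toLp 2 φ) =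
      ∑ v, (starRingEnd ℂ) (e s v) * φ v := by
    simp [PiLp.inner_apply, mul_comm]
  have hon : Orthonormal ℂ fun s => WithLp.toLp 2 (e s) :=
    orthonormal_iff_ite.mpr fun s t => (hinner s (e t)).trans (horth s t)
  have : Nonempty ι := ⟨s₀⟩
  have hspan : ⊤ ≤ Submodule.span ℂ (Set.range fun s => WithLp.toLp 2 (e s)) :=
    (hon.linearIndependent.span_eq_top_of_card_eq_finrank (by simpa using hcard)).ge
  classical
  have key := (OrthonormalBasis.mk hon hspan).sq_mul_sum_norm_inner_le
    (Matrix.toEuclideanLin T) (fun s => (lam s : ℂ))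
    (fun s => by simp [Matrix.toLpLin_toLp, hT])
    (Finset.univ.filter fun s => s ≠ s₀) (β : ℂ) hg.le
    (fun s hs => by
      rw [← Complex.ofReal_sub, Complex.norm_real]
      exact hgap s (Finset.mem_filter.mp hs).2)
    (WithLp.toLp 2 ψ)
  simp only [OrthonormalBasis.coe_mk, hinner] at key
  rw [le_div_iff₀ (by positivity), mul_comm]
  exact key.trans (pow_le_pow_left₀ (norm_nonneg _) hψ 2)
end

section
/- Let n ≥ 1 and let M be a Hermitian n × n complex matrix with eigenvalues (λ_i)_{i} (counted with multiplicity, as given by the spectral theorem for Hermitian matrices). Then ∑_i |λ_i| ≤ ∑_{i,j} ‖M i j‖, i.e. the sum of the absolute values of the eigenvalues of M is at most the sum of the absolute values of its entries. -/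
theorem Matrix.sum_norm_sq_row_of_mem_unitaryGroup {𝕜 ι : Type*} [RCLike 𝕜] [Fintype ι]
    [DecidableEq ι] {U : Matrix ι ι 𝕜} (hU : U ∈ Matrix.unitaryGroup ι 𝕜) (i : ι) :
    ∑ k, ‖U i k‖ ^ 2 = 1 := by
  have h := congrFun (congrFun (Matrix.mem_unitaryGroup_iff.mp hU) i) i
  simp only [Matrix.mul_apply, Matrix.star_apply, Matrix.one_apply_eq, RCLike.star_def,
    RCLike.mul_conj] at h
  exact_mod_cast h

theorem Matrix.sum_norm_mul_norm_row_le_one_of_mem_unitaryGroup {𝕜 ι : Type*} [RCLike 𝕜]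
    [Fintype ι] [DecidableEq ι] {U : Matrix ι ι 𝕜} (hU : U ∈ Matrix.unitaryGroup ι 𝕜) (i j : ι) :
    ∑ k, ‖U i k‖ * ‖U j k‖ ≤ 1 := by
  have h := Finset.sum_mul_sq_le_sq_mul_sq Finset.univ (fun k => ‖U i k‖) (fun k => ‖U j k‖)
  simp only [sum_norm_sq_row_of_mem_unitaryGroup hU, mul_one] at h
  exact (sq_le_one_iff_abs_le_one _).mp h |> le_of_abs_le

theorem Matrix.IsHermitian.abs_eigenvalues_le_sum_norm {𝕜 ι : Type*} [RCLike 𝕜] [Fintype ι]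
    [DecidableEq ι] {A : Matrix ι ι 𝕜} (hA : A.IsHermitian) (k : ι) :
    |hA.eigenvalues k| ≤ ∑ i, ∑ j, ‖A i j‖ *
      (‖hA.eigenvectorUnitary.1 i k‖ * ‖hA.eigenvectorUnitary.1 j k‖) := by
  rw [hA.eigenvalues_eq]
  refine (RCLike.abs_re_le_norm _).trans ?_
  simp only [dotProduct, Matrix.mulVec, Finset.mul_sum]
  refine (norm_sum_le _ _).trans (Finset.sum_le_sum fun i _ => ?_)
  refine (norm_sum_le _ _).trans (Finset.sum_le_sum fun j _ => le_of_eq ?_)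
  simp only [norm_mul, Pi.star_apply, norm_star, Matrix.IsHermitian.eigenvectorUnitary_apply]
  ring

/-- for a Hermitian matrix, the sum of the absolute values of its
eigenvalues is at most the sum of the absolute values of its entries. -/
theorem abs_eigenvalues_le_abs_entries
    (n : ℕ) (hn : 1 ≤ n) (M : Matrix (Fin n) (Fin n) ℂ) (hM : M.IsHermitian) :
    ∑ i, |hM.eigenvalues i| ≤ ∑ i, ∑ j, ‖M i j‖ := by
  refine (Finset.sum_le_sum fun k _ => hM.abs_eigenvalues_le_sum_norm k).trans ?_
  rw [Finset.sum_comm]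
  refine Finset.sum_le_sum fun i _ => ?_
  rw [Finset.sum_comm]
  refine Finset.sum_le_sum fun j _ => ?_
  rw [← Finset.mul_sum]
  exact mul_le_of_le_one_right (norm_nonneg _)
    (Matrix.sum_norm_mul_norm_row_le_one_of_mem_unitaryGroup hM.eigenvectorUnitary.2 i j)
end

section
/- Let d ≥ 1 and let A₀, A₁, B be d × d complex matrices with A₀ᴴ = A₀, A₁ᴴ = A₁, Bᴴ = B, A₀² = A₁² = B² = 1, and B commuting with both A₀ and A₁. Set Ã = (1/√2)·(A₀ − A₁). If ψ : Fin d → ℂ satisfies ‖(1 − Ã·B).mulVec ψ‖ ≤ δ in the Euclidean norm, then ‖(A₀·A₁ + A₁·A₀).mulVec ψ‖ ≤ 2·(1 + √2)·δ. -/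
open scoped Matrix.Norms.L2Operator in
/-- A Hermitian involution has operator norm at most one. -/
theorem Matrix.IsHermitian.l2_opNorm_le_one_of_mul_self {n : Type*} [Fintype n] [DecidableEq n]
    {U : Matrix n n ℂ} (hU : U.IsHermitian) (hU2 : U * U = 1) : ‖U‖ ≤ 1 := by
  have h := Matrix.l2_opNorm_conjTranspose_mul_self U
  rw [hU.eq, hU2] at h
  rcases isEmpty_or_nonempty n with _ | _
  · simp [Subsingleton.elim U 0]
  · rw [CStarRing.norm_one] at h
    nlinarith [norm_nonneg U]

open scoped Matrix.Norms.L2Operator in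
/-- The normalized difference of two Hermitian involutions, multiplied by a third one, has
operator norm at most `√2`. -/
theorem l2_opNorm_smul_sub_mul_le_sqrt_two {n : Type*} [Fintype n] [DecidableEq n]
    {A₀ A₁ B : Matrix n n ℂ}
    (hA₀ : A₀.IsHermitian) (hA₁ : A₁.IsHermitian) (hB : B.IsHermitian)
    (hA₀2 : A₀ * A₀ = 1) (hA₁2 : A₁ * A₁ = 1) (hB2 : B * B = 1) :
    ‖(((Real.sqrt 2 : ℂ))⁻¹ • (A₀ - A₁)) * B‖ ≤ Real.sqrt 2 := by
  have hc : ‖((Real.sqrt 2 : ℂ))⁻¹‖ = (Real.sqrt 2)⁻¹ := by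
    rw [norm_inv, Complex.norm_real, Real.norm_of_nonneg (Real.sqrt_nonneg 2)]
  calc _ ≤ ‖((Real.sqrt 2 : ℂ))⁻¹ • (A₀ - A₁)‖ * ‖B‖ := norm_mul_le _ _
    _ ≤ ((Real.sqrt 2)⁻¹ * (1 + 1)) * 1 := by
      rw [norm_smul, hc]
      gcongr
      · exact (norm_sub_le _ _).trans (add_le_add (hA₀.l2_opNorm_le_one_of_mul_self hA₀2)
          (hA₁.l2_opNorm_le_one_of_mul_self hA₁2))
      · exact hB.l2_opNorm_le_one_of_mul_self hB2
    _ = Real.sqrt 2 := by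
      rw [mul_one, one_add_one_eq_two, inv_mul_eq_div, Real.div_sqrt]

/-- The anticommutator of two involutions factors through `1 - Ã * B`, where
`Ã = (1/√2) • (A₀ - A₁)` and `B` is an involution commuting with both of them. -/
theorem anticommutator_eq_smul_mul {n : Type*} [Fintype n] [DecidableEq n]
    {A₀ A₁ B : Matrix n n ℂ}
    (hA₀2 : A₀ * A₀ = 1) (hA₁2 : A₁ * A₁ = 1) (hB2 : B * B = 1)
    (hBA₀ : Commute B A₀) (hBA₁ : Commute B A₁) :
    A₀ * A₁ + A₁ * A₀ =
      ((2 : ℂ) • (1 + (((Real.sqrt 2 : ℂ))⁻¹ • (A₀ - A₁)) * B)) *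
        (1 - (((Real.sqrt 2 : ℂ))⁻¹ • (A₀ - A₁)) * B) := by
  have hc : ((Real.sqrt 2 : ℂ))⁻¹ * ((Real.sqrt 2 : ℂ))⁻¹ = 2⁻¹ := by
    rw [← mul_inv, ← Complex.ofReal_mul, Real.mul_self_sqrt zero_le_two, Complex.ofReal_ofNat]
  have hsq : (((Real.sqrt 2 : ℂ))⁻¹ • (A₀ - A₁) * B) * (((Real.sqrt 2 : ℂ))⁻¹ • (A₀ - A₁) * B) =
      (2 : ℂ)⁻¹ • ((A₀ - A₁) * (A₀ - A₁)) := by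
    rw [((hBA₀.sub_right hBA₁).smul_right _).mul_mul_mul_comm, hB2, mul_one,
      smul_mul_smul_comm, hc]
  have hdiff : (A₀ - A₁) * (A₀ - A₁) = (2 : ℂ) • 1 - (A₀ * A₁ + A₁ * A₀) := by
    rw [sub_mul, mul_sub, mul_sub, hA₀2, hA₁2, two_smul]
    abel
  rw [smul_mul_assoc, ← (Commute.one_left _).mul_self_sub_mul_self_eq, hsq, hdiff, one_mul,
    smul_sub, smul_smul, mul_inv_cancel₀ two_ne_zero, one_smul, sub_sub_cancel]

open scoped Matrix.Norms.L2Operator in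
/-- Applying `2 • (1 + T)` scales Euclidean norms by at most `2 * (1 + r)` if `‖T‖ ≤ r`. -/
theorem norm_toLp_mulVec_two_smul_one_add_le {n : Type*} [Fintype n] [DecidableEq n]
    {T : Matrix n n ℂ} {r : ℝ} (hT : ‖T‖ ≤ r) (v : n → ℂ) :
    ‖WithLp.toLp 2 (((2 : ℂ) • (1 + T)).mulVec v)‖ ≤ 2 * (1 + r) * ‖WithLp.toLp 2 v‖ := by
  refine (Matrix.l2_opNorm_mulVec _ (WithLp.toLp 2 v)).trans ?_
  gcongr
  rw [norm_smul, Complex.norm_ofNat]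
  gcongr
  exact (norm_add_le _ _).trans (add_le_add
    (Matrix.isHermitian_one.l2_opNorm_le_one_of_mul_self (one_mul 1)) hT)

/-- robust anticommutation. With dichotomic Hermitian `A₀, A₁, B`, `B`
commuting with `A₀, A₁`, and `‖(1 − Ã·B)ψ‖ ≤ δ` for `Ã = (1/√2)(A₀ − A₁)`, the
observables `A₀, A₁` approximately anticommute on `ψ`:
`‖(A₀A₁ + A₁A₀)ψ‖ ≤ 2(1 + √2)δ`. -/
theorem robust_anticommutation
    (d : ℕ) (hd : 1 ≤ d) (A₀ A₁ B : Matrix (Fin d) (Fin d) ℂ)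
    (hA₀ : A₀.IsHermitian) (hA₁ : A₁.IsHermitian) (hB : B.IsHermitian)
    (hA₀2 : A₀ * A₀ = 1) (hA₁2 : A₁ * A₁ = 1) (hB2 : B * B = 1)
    (hBA₀ : Commute B A₀) (hBA₁ : Commute B A₁)
    (ψ : Fin d → ℂ) (δ : ℝ)
    (hψ : ‖(WithLp.equiv 2 (Fin d → ℂ)).symm
        (((1 : Matrix (Fin d) (Fin d) ℂ) -
          (((Real.sqrt 2 : ℂ))⁻¹ • (A₀ - A₁)) * B).mulVec ψ)‖ ≤ δ) :
    ‖(WithLp.equiv 2 (Fin d → ℂ)).symm ((A₀ * A₁ + A₁ * A₀).mulVec ψ)‖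
      ≤ 2 * (1 + Real.sqrt 2) * δ := by
  rw [anticommutator_eq_smul_mul hA₀2 hA₁2 hB2 hBA₀ hBA₁, ← Matrix.mulVec_mulVec]
  refine (norm_toLp_mulVec_two_smul_one_add_le
    (l2_opNorm_smul_sub_mul_le_sqrt_two hA₀ hA₁ hB hA₀2 hA₁2 hB2) _).trans ?_
  gcongr
  exact hψ
end

section
/- Let N ≥ 2 and let j ∈ Fin N. Define O : Matrix (Fin N → Bool) (Fin N → Bool) ℂ by O u v = ∏_{i ∈ Fin N} m_i (u i) (v i), where m_i is the Pauli Y matrix if i = j and the Pauli X matrix otherwise. Then ⟨φ₀, O.mulVec φ₀⟩ = 0, where φ₀ is the N-qubit GHZ state (the GHZ-like vector for the constant-false string). -/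
noncomputable section

/-- The GHZ state is the normalized sum of the two constant basis vectors. -/
theorem ghz_const_false (N : ℕ) [NeZero N] :
    ghz N (fun _ => false) = (1 / (Real.sqrt 2 : ℂ)) •
      (Pi.single (fun _ => false) 1 + Pi.single (fun _ => true) 1) := by
  funext v
  simp [ghz, eps, Pi.single_apply, mul_add]

/-- Matrix elements between constant basis vectors of the tensor product with Pauli `Y` at site `j`
and Pauli `X` elsewhere. -/
theorem prod_pauliY_pauliX_const {N : ℕ} (j : Fin N) (a b : Bool) :
    ∏ i, (if i = j then PauliY else PauliX) a b = if b = !a then PauliY a b else 0 := by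
  rw [Finset.prod_eq_mul_prod_sdiff_singleton_of_mem (Finset.mem_univ j), if_pos rfl]
  split_ifs with h
  · rw [Finset.prod_eq_one, mul_one]
    intro i hi
    have hij : i ≠ j := by simpa using hi
    simp [hij, PauliX, h]
  · have : PauliY a b = 0 := by
      cases a <;> cases b <;> simp_all [PauliY]
    rw [this, zero_mul]

/-- the GHZ correlator of the tensor observable with Pauli `Y` at a single
site `j` and Pauli `X` at all other sites vanishes. -/
theorem ghz_single_Y_correlator
    (N : ℕ) [NeZero N] (hN : 2 ≤ N) (j : Fin N)
    (O : Matrix (Fin N → Bool) (Fin N → Bool) ℂ)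
    (hO : O = Matrix.of fun u v =>
      ∏ i, (if i = j then PauliY else PauliX) (u i) (v i)) :
    ∑ v, (starRingEnd ℂ) (ghz N (fun _ => false) v) *
      (O.mulVec (ghz N (fun _ => false))) v = 0 := by
  subst hO
  rw [ghz_const_false]
  simp only [Matrix.mulVec_smul, Matrix.mulVec_add, Matrix.mulVec_single_one, Pi.smul_apply,
    Pi.add_apply, Pi.single_apply, Matrix.col_apply, Matrix.of_apply, smul_eq_mul,
    map_add, mul_add, add_mul, Finset.sum_add_distrib, apply_ite (starRingEnd ℂ),
    map_zero, mul_ite, ite_mul, mul_one, mul_zero, zero_mul, Finset.sum_ite_eq',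
    Finset.mem_univ, if_true, prod_pauliY_pauliX_const]
  simp [PauliY]
end
end
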